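/- arXiv:1005.3448 — 2 statements merged into one kernel-verified Lean document; each statement's English description precedes it below -/
import Mathlib

section
/- For every even positive integer δ there exist polynomials x, y ∈ ℤ[t] with deg(x) = 2δ, deg(y) = 3δ, and deg(x^3 - y^2) = δ + 5. -/
open Polynomial

/-- `p` has degree `n` with positive leading coefficient. -/
def HasPosLead (p : ℤ[X]) (n : ℕ) : Prop :=
  p.natDegree ≤ n ∧ 0 < p.coeff n

theorem HasPosLead.natDegree_eq {p : ℤ[X]} {n : ℕ} (hp : HasPosLead p n) : p.natDegree = n :=
  natDegree_eq_of_le_of_coeff_ne_zero hp.1 hp.2.ne'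

theorem HasPosLead.ne_zero {p : ℤ[X]} {n : ℕ} (hp : HasPosLead p n) : p ≠ 0 := by
  rintro rfl
  simpa using hp.2

theorem HasPosLead.add {p q : ℤ[X]} {n : ℕ} (hp : HasPosLead p n) (hq : HasPosLead q n) :
    HasPosLead (p + q) n :=
  ⟨natDegree_add_le_of_degree_le hp.1 hq.1, by
    rw [coeff_add]
    exact add_pos hp.2 hq.2⟩

theorem HasPosLead.mul {p q : ℤ[X]} {m n : ℕ} (hp : HasPosLead p m) (hq : HasPosLead q n) :
    HasPosLead (p * q) (m + n) :=
  ⟨natDegree_mul_le_of_le hp.1 hq.1, by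
    rw [coeff_mul_add_eq_of_natDegree_le hp.1 hq.1]
    exact mul_pos hp.2 hq.2⟩

theorem hasPosLead_X : HasPosLead X 1 := ⟨natDegree_X_le, by simp⟩

theorem hasPosLead_C {a : ℤ} (ha : 0 < a) : HasPosLead (C a) 0 := ⟨by simp, by simpa using ha⟩

theorem hasPosLead_C_mul_X_sq_add_one {a : ℤ} (ha : 0 < a) :
    HasPosLead (C a * X ^ 2 + 1) 2 := by
  refine ⟨by compute_degree, ?_⟩
  simpa [coeff_one] using ha

/-- The polynomial Pell equation `z² - (t² + 1) u² = -1` has solutions with `z` of every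
odd degree. -/
theorem exists_polynomial_negative_pell (m : ℕ) :
    ∃ z u : ℤ[X], z ^ 2 + 1 = (C 1 * X ^ 2 + 1) * u ^ 2 ∧
      HasPosLead z (2 * m + 1) ∧ HasPosLead u (2 * m) := by
  induction m with
  | zero =>
    refine ⟨X, C 1, ?_, hasPosLead_X, hasPosLead_C one_pos⟩
    simp
  | succ m ih =>
    obtain ⟨z, u, h, hz, hu⟩ := ih
    have h₂ := hasPosLead_C_mul_X_sq_add_one (a := 2) two_pos
    have hX := (hasPosLead_C (a := 2) two_pos).mul hasPosLead_X
    have hD := hasPosLead_C_mul_X_sq_add_one (a := 1) one_pos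
    refine ⟨(C 2 * X ^ 2 + 1) * z + C 2 * X * ((C 1 * X ^ 2 + 1) * u),
      (C 2 * X ^ 2 + 1) * u + C 2 * X * z, ?_, ?_, ?_⟩
    · simp only [map_one, map_ofNat] at h ⊢
      linear_combination h
    · convert (h₂.mul hz).add (n := 2 + (2 * m + 1)) ?_ using 1
      · ring
      · convert hX.mul (hD.mul hu) using 1
        ring
    · convert (h₂.mul hu).add (n := 2 + 2 * m) ?_ using 1
      · ring
      · convert hX.mul hz using 1
        ring

theorem natDegree_sq_add_C_mul_add_C (z : ℤ[X]) (a b : ℤ) :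
    (z ^ 2 + C a * z + C b).natDegree = 2 * z.natDegree := by
  have h : z ^ 2 + C a * z + C b = (X ^ 2 + C a * X + C b).comp z := by simp
  have h₂ : (X ^ 2 + C a * X + C b : ℤ[X]).natDegree = 2 := by compute_degree!
  rw [h, natDegree_comp, h₂]

theorem stmt_6 (δ : ℕ) (hpos : 0 < δ) (heven : Even δ) :
    ∃ x y : Polynomial ℤ, x.natDegree = 2 * δ ∧ y.natDegree = 3 * δ ∧
      (x^3 - y^2).natDegree = δ + 5 := by
  obtain ⟨m, rfl⟩ : ∃ m, δ = 2 * m + 2 := by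
    obtain ⟨k, rfl⟩ := heven
    exact ⟨k - 1, by lia⟩
  obtain ⟨z, u, h, hz, hu⟩ := exists_polynomial_negative_pell m
  have hD := hasPosLead_C_mul_X_sq_add_one (a := 1) one_pos
  set D : ℤ[X] := C 1 * X ^ 2 + 1
  have hq (a b : ℤ) : (z ^ 2 + C a * z + C b).natDegree = 2 * (2 * m + 1) := by
    rw [natDegree_sq_add_C_mul_add_C, hz.natDegree_eq]
  have hq₀ (a b : ℤ) : z ^ 2 + C a * z + C b ≠ 0 :=
    ne_zero_of_natDegree_gt (n := 0) (by rw [hq]; lia)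
  have hl : (C 54 * z + C (-297)).natDegree = 2 * m + 1 := by
    rw [natDegree_add_C, natDegree_C_mul (by norm_num), hz.natDegree_eq]
  have hl₀ : C 54 * z + C (-297) ≠ 0 :=
    ne_zero_of_natDegree_gt (n := 0) (by rw [hl]; lia)
  have hdiff : (D * (z ^ 2 + C (-6) * z + C 4)) ^ 3 -
      (D ^ 2 * u * (z ^ 2 + C (-9) * z + C 19)) ^ 2 = D ^ 3 * (C 54 * z + C (-297)) := by
    simp only [map_neg, map_ofNat]
    linear_combination D ^ 3 * (z ^ 2 - 9 * z + 19) ^ 2 * h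
  refine ⟨D * (z ^ 2 + C (-6) * z + C 4), D ^ 2 * u * (z ^ 2 + C (-9) * z + C 19), ?_, ?_, ?_⟩
  · rw [natDegree_mul hD.ne_zero (hq₀ _ _), hD.natDegree_eq, hq]
    ring
  · rw [natDegree_mul (mul_ne_zero (pow_ne_zero _ hD.ne_zero) hu.ne_zero) (hq₀ _ _),
      natDegree_mul (pow_ne_zero _ hD.ne_zero) hu.ne_zero, natDegree_pow, hD.natDegree_eq,
      hu.natDegree_eq, hq]
    ring
  · rw [hdiff, natDegree_mul (pow_ne_zero _ hD.ne_zero) hl₀, natDegree_pow, hD.natDegree_eq, hl]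
    ring
end

section
/- For every ε > 0 there exist polynomials x, y ∈ ℤ[t] with x^3 ≠ y^2, deg(x) > 0, and deg(x^3 - y^2)/deg(x) < 1/2 + ε. -/
open Polynomial

/-- The polynomial Pell equation `S ^ 2 + 1 = (X ^ 2 + 1) * W ^ 2` has solutions of degree `3 ^ k`,
obtained by iterating the triple-angle formula for `sinh`. -/
theorem exists_pell_natDegree_eq_three_pow (k : ℕ) :
    ∃ S W : ℤ[X], S ^ 2 + 1 = (X ^ 2 + 1) * W ^ 2 ∧ S.natDegree = 3 ^ k := by
  induction k with
  | zero => exact ⟨X, 1, by ring, by simp⟩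
  | succ k ih =>
    obtain ⟨S, W, h, hS⟩ := ih
    refine ⟨(4 * X ^ 3 + 3 * X : ℤ[X]).comp S, (4 * S ^ 2 + 1) * W, ?_, ?_⟩
    · simp only [add_comp, mul_comp, pow_comp, X_comp, ofNat_comp]
      linear_combination (4 * S ^ 2 + 1) ^ 2 * h
    · have hP : (4 * X ^ 3 + 3 * X : ℤ[X]).natDegree = 3 := by compute_degree!
      rw [natDegree_comp, hP, hS, pow_succ']

/-- Danilov's identity, along a solution of the Pell equation `S ^ 2 + 1 = D * W ^ 2`. -/
theorem cube_sub_sq_of_pell {R : Type*} [CommRing R] {D S W : R} (h : S ^ 2 + 1 = D * W ^ 2) :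
    (D * (S ^ 2 - 6 * S + 4)) ^ 3 - (D ^ 2 * (S ^ 2 - 9 * S + 19) * W) ^ 2 =
      27 * D ^ 3 * (2 * S - 11) := by
  linear_combination D ^ 3 * (S ^ 2 - 9 * S + 19) ^ 2 * h

theorem stmt_7 (ε : ℝ) (hε : 0 < ε) :
    ∃ x y : Polynomial ℤ, x^3 ≠ y^2 ∧ 0 < x.natDegree ∧
      ((x^3 - y^2).natDegree : ℝ) / (x.natDegree : ℝ) < 1/2 + ε := by
  obtain ⟨k, hk⟩ := pow_unbounded_of_one_lt (5 / ε) (by norm_num : (1 : ℝ) < 3)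
  obtain ⟨S, W, h, hS⟩ := exists_pell_natDegree_eq_three_pow k
  have hD : (X ^ 2 + 1 : ℤ[X]).natDegree = 2 := by compute_degree!
  have hQ : (S ^ 2 - 6 * S + 4).natDegree = 2 * 3 ^ k := by
    have hP : (X ^ 2 - 6 * X + 4 : ℤ[X]).natDegree = 2 := by compute_degree!
    have hc : (X ^ 2 - 6 * X + 4 : ℤ[X]).comp S = S ^ 2 - 6 * S + 4 := by simp
    rw [← hc, natDegree_comp, hP, hS]
  have hL : (2 * S - 11).natDegree = 3 ^ k := by
    have hP : (2 * X - 11 : ℤ[X]).natDegree = 1 := by compute_degree!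
    have hc : (2 * X - 11 : ℤ[X]).comp S = 2 * S - 11 := by simp
    rw [← hc, natDegree_comp, hP, hS]
    ring
  have hpos : 0 < 3 ^ k := by positivity
  have hD0 : (X ^ 2 + 1 : ℤ[X]) ≠ 0 := ne_zero_of_natDegree_gt (n := 0) (by omega)
  have hQ0 : S ^ 2 - 6 * S + 4 ≠ 0 := ne_zero_of_natDegree_gt (n := 0) (by omega)
  have hL0 : 2 * S - 11 ≠ 0 := ne_zero_of_natDegree_gt (n := 0) (by omega)
  have h27 : (27 : ℤ[X]) ≠ 0 := by norm_num
  have key := cube_sub_sq_of_pell h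
  have hx : ((X ^ 2 + 1) * (S ^ 2 - 6 * S + 4)).natDegree = 2 * 3 ^ k + 2 := by
    rw [natDegree_mul hD0 hQ0, hD, hQ, add_comm]
  have hxy : (27 * (X ^ 2 + 1) ^ 3 * (2 * S - 11)).natDegree = 3 ^ k + 6 := by
    rw [natDegree_mul (mul_ne_zero h27 (pow_ne_zero 3 hD0)) hL0,
      natDegree_mul h27 (pow_ne_zero 3 hD0), natDegree_pow, hD, hL, natDegree_ofNat]
    ring
  refine ⟨(X ^ 2 + 1) * (S ^ 2 - 6 * S + 4), (X ^ 2 + 1) ^ 2 * (S ^ 2 - 9 * S + 19) * W, ?_, ?_, ?_⟩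
  · rw [← sub_ne_zero, key]
    exact mul_ne_zero (mul_ne_zero h27 (pow_ne_zero 3 hD0)) hL0
  · rw [hx]
    positivity
  · rw [key, hxy, hx]
    push_cast
    rw [div_lt_iff₀ (by positivity)]
    rw [div_lt_iff₀ hε] at hk
    linarith
end
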